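/- Let N₁ ≥ 2, N₂ ≥ 2, N₃ ≥ 1. The function ‖·‖' on ℝ^{N₁×N₂×N₃} defined by ‖X‖' = inf { (Σ_{r=1}^R (‖u_r^{(1)}‖₂ · ‖u_r^{(2)}‖₂ · ‖u_r^{(3)}‖₂)^{2/3})^{3/2} : R ∈ ℕ, u ∈ U_R(X) } is not convex; in particular there exist tensors X, Y ∈ ℝ^{N₁×N₂×N₃} with ‖(X + Y)/2‖' > (‖X‖' + ‖Y‖')/2. -/

import Mathlib

open Finset

/-- The vector ℓ_p norm on `ℝ^n`. -/
noncomputable def vecLpNorm (p : ℝ) {n : ℕ} (v : Fin n → ℝ) : ℝ :=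
  (∑ i, |v i| ^ p) ^ (1 / p)

/-- `u = (u1, u2, u3)` is a rank-`R` CP decomposition of the tensor `X`. -/
def IsCPDecomp {N₁ N₂ N₃ R : ℕ} (X : Fin N₁ × Fin N₂ × Fin N₃ → ℝ)
    (u1 : Fin R → Fin N₁ → ℝ) (u2 : Fin R → Fin N₂ → ℝ)
    (u3 : Fin R → Fin N₃ → ℝ) : Prop :=
  ∀ i j k, X (i, j, k) = ∑ r, u1 r i * u2 r j * u3 r k

/-- The (2/3)-"nuclear" quantity `‖X‖'`, infimum over all CP decompositions of `X`
of the ℓ_{2/3} quasi-norm of the spectrum. -/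
noncomputable def tensorNorm23 {N₁ N₂ N₃ : ℕ} (X : Fin N₁ × Fin N₂ × Fin N₃ → ℝ) : ℝ :=
  sInf {y : ℝ | ∃ (R : ℕ) (u1 : Fin R → Fin N₁ → ℝ) (u2 : Fin R → Fin N₂ → ℝ)
    (u3 : Fin R → Fin N₃ → ℝ), IsCPDecomp X u1 u2 u3 ∧
    y = (∑ r, (vecLpNorm 2 (u1 r) * vecLpNorm 2 (u2 r) * vecLpNorm 2 (u3 r))
      ^ ((2 : ℝ) / 3)) ^ ((3 : ℝ) / 2)}

lemma vecLpNorm_nonneg (p : ℝ) {n : ℕ} (v : Fin n → ℝ) : 0 ≤ vecLpNorm p v :=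
  Real.rpow_nonneg (Finset.sum_nonneg fun _ _ => Real.rpow_nonneg (abs_nonneg _) _) _

lemma vecLpNorm_two_eq_sqrt {n : ℕ} (v : Fin n → ℝ) :
    vecLpNorm 2 v = √(∑ i, v i ^ 2) := by
  simp [vecLpNorm, Real.sqrt_eq_rpow]

lemma vecLpNorm_two_sq {n : ℕ} (v : Fin n → ℝ) :
    vecLpNorm 2 v ^ 2 = ∑ i, v i ^ 2 := by
  rw [vecLpNorm_two_eq_sqrt, Real.sq_sqrt (Finset.sum_nonneg fun _ _ => sq_nonneg _)]

lemma vecLpNorm_two_single {n : ℕ} (i : Fin n) (c : ℝ) :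
    vecLpNorm 2 (Pi.single i c) = |c| := by
  rw [vecLpNorm_two_eq_sqrt, Finset.sum_eq_single i]
  · simp [Real.sqrt_sq_eq_abs]
  · intro j _ hj
    simp [hj]
  · simp

lemma abs_le_vecLpNorm_two {n : ℕ} (v : Fin n → ℝ) (i : Fin n) : |v i| ≤ vecLpNorm 2 v := by
  rw [vecLpNorm_two_eq_sqrt]
  exact Real.abs_le_sqrt
    (Finset.single_le_sum (f := fun j => v j ^ 2) (fun _ _ => sq_nonneg _) (Finset.mem_univ i))

lemma sq_add_sq_le_vecLpNorm_two_sq {n : ℕ} (v : Fin n → ℝ) {i j : Fin n} (hij : i ≠ j) :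
    v i ^ 2 + v j ^ 2 ≤ vecLpNorm 2 v ^ 2 := by
  rw [vecLpNorm_two_sq, ← Finset.sum_pair (f := fun l => v l ^ 2) hij]
  exact Finset.sum_le_sum_of_subset_of_nonneg (Finset.subset_univ _) fun _ _ _ => sq_nonneg _

/-- The infimum defining `tensorNorm23 X` is bounded above by the value at any decomposition. -/
lemma tensorNorm23_le {N₁ N₂ N₃ R : ℕ} {X : Fin N₁ × Fin N₂ × Fin N₃ → ℝ}
    {u1 : Fin R → Fin N₁ → ℝ} {u2 : Fin R → Fin N₂ → ℝ} {u3 : Fin R → Fin N₃ → ℝ}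
    (h : IsCPDecomp X u1 u2 u3) :
    tensorNorm23 X ≤ (∑ r, (vecLpNorm 2 (u1 r) * vecLpNorm 2 (u2 r) * vecLpNorm 2 (u3 r))
      ^ ((2 : ℝ) / 3)) ^ ((3 : ℝ) / 2) := by
  refine csInf_le ⟨0, ?_⟩ ⟨R, u1, u2, u3, h, rfl⟩
  rintro y ⟨R, u1, u2, u3, -, rfl⟩
  exact Real.rpow_nonneg (Finset.sum_nonneg fun _ _ => Real.rpow_nonneg
    (mul_nonneg (mul_nonneg (vecLpNorm_nonneg _ _) (vecLpNorm_nonneg _ _))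
      (vecLpNorm_nonneg _ _)) _) _

lemma tensorNorm23_rankOne_le {N₁ N₂ N₃ : ℕ} (a : Fin N₁ → ℝ) (b : Fin N₂ → ℝ)
    (c : Fin N₃ → ℝ) :
    tensorNorm23 (fun t => a t.1 * b t.2.1 * c t.2.2) ≤
      vecLpNorm 2 a * vecLpNorm 2 b * vecLpNorm 2 c := by
  refine (tensorNorm23_le (R := 1) (u1 := fun _ => a) (u2 := fun _ => b) (u3 := fun _ => c)
    (by intro i j k; simp)).trans_eq ?_
  rw [Fin.sum_univ_one, ← Real.rpow_mul
    (mul_nonneg (mul_nonneg (vecLpNorm_nonneg _ _) (vecLpNorm_nonneg _ _)) (vecLpNorm_nonneg _ _))]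
  norm_num

lemma sq_sum_cube_le {ι : Type*} (A : Finset ι) (s : ι → ℝ) (hs : ∀ r ∈ A, 0 ≤ s r) {M : ℝ}
    (hM0 : 0 ≤ M) (hM : ∀ r ∈ A, s r ^ 2 ≤ M) :
    (∑ r ∈ A, s r ^ 3) ^ 2 ≤ M * (∑ r ∈ A, s r ^ 2) ^ 2 := by
  have h : ∑ r ∈ A, s r ^ 3 ≤ √M * ∑ r ∈ A, s r ^ 2 := by
    rw [Finset.mul_sum]
    refine Finset.sum_le_sum fun r hr => ?_
    have := mul_le_mul_of_nonneg_right (Real.le_sqrt_of_sq_le (hM r hr)) (sq_nonneg (s r))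
    linarith [this, show s r ^ 3 = s r * s r ^ 2 by ring]
  calc (∑ r ∈ A, s r ^ 3) ^ 2 ≤ (√M * ∑ r ∈ A, s r ^ 2) ^ 2 :=
        pow_le_pow_left₀ (Finset.sum_nonneg fun r hr => pow_nonneg (hs r hr) 3) h 2
    _ = M * (∑ r ∈ A, s r ^ 2) ^ 2 := by rw [mul_pow, Real.sq_sqrt hM0]

/-- If the cubes sum to at least `2`, and still to at least `1` after dropping any one of them,
then no single term dominates, and the sum of squares exceeds the value `4 ^ (1 / 3)` that a
single term would give. -/
lemma le_sum_sq_pow_three {ι : Type*} [Fintype ι] [DecidableEq ι] (s : ι → ℝ)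
    (hs : ∀ r, 0 ≤ s r) (h2 : 2 ≤ ∑ r, s r ^ 3)
    (h1 : ∀ r₀, 1 ≤ ∑ r ∈ univ.erase r₀, s r ^ 3) :
    16 / 3 ≤ (∑ r, s r ^ 2) ^ 3 := by
  set T := ∑ r, s r ^ 2 with hT
  have hT0 : 0 ≤ T := Finset.sum_nonneg fun _ _ => sq_nonneg _
  by_cases h : ∀ r, s r ^ 2 ≤ 3 / 4 * T
  · have := sq_sum_cube_le univ s (fun r _ => hs r) (by positivity) fun r _ => h r
    nlinarith
  · push Not at h
    obtain ⟨r₀, hr₀⟩ := h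
    set T' := ∑ r ∈ univ.erase r₀, s r ^ 2 with hT'
    have hT'0 : 0 ≤ T' := Finset.sum_nonneg fun _ _ => sq_nonneg _
    have hsplit : s r₀ ^ 2 + T' = T := Finset.add_sum_erase _ (fun r => s r ^ 2) (mem_univ r₀)
    have hcube := sq_sum_cube_le (univ.erase r₀) s (fun r _ => hs r) hT'0 fun r hr =>
      Finset.single_le_sum (f := fun r => s r ^ 2) (fun _ _ => sq_nonneg _) hr
    have hT'1 : 1 ≤ T' := by
      by_contra! hlt
      have : T' * T' ^ 2 < 1 := by
        rw [← pow_succ']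
        exact pow_lt_one₀ hT'0 hlt (by norm_num)
      nlinarith [h1 r₀]
    have : (4 : ℝ) ^ 3 ≤ T ^ 3 := pow_le_pow_left₀ (by norm_num) (by linarith) 3
    linarith

/-- A scalar expression bounded by Cauchy-Schwarz: contraction of a product tensor with the
same planar vector `(p, q)` in the first two modes and a coordinate vector in the third. -/
lemma contraction_le_mul_norms {N₁ N₂ N₃ : ℕ} (a : Fin N₁ → ℝ) (b : Fin N₂ → ℝ)
    (c : Fin N₃ → ℝ) {i i' : Fin N₁} (hi : i ≠ i') {j j' : Fin N₂} (hj : j ≠ j') (k : Fin N₃)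
    (p q : ℝ) :
    (p * a i + q * a i') * (p * b j + q * b j') * c k ≤
      (p ^ 2 + q ^ 2) * (vecLpNorm 2 a * vecLpNorm 2 b * vecLpNorm 2 c) := by
  have key : ∀ x y n : ℝ, 0 ≤ n → x ^ 2 + y ^ 2 ≤ n ^ 2 →
      |p * x + q * y| ≤ √(p ^ 2 + q ^ 2) * n := by
    intro x y n hn h
    refine abs_le_of_sq_le_sq ?_ (by positivity)
    rw [mul_pow, Real.sq_sqrt (by positivity)]
    nlinarith [sq_nonneg (p * y - q * x),
      mul_le_mul_of_nonneg_left h (show 0 ≤ p ^ 2 + q ^ 2 by positivity)]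
  have ha := key _ _ _ (vecLpNorm_nonneg 2 a) (sq_add_sq_le_vecLpNorm_two_sq a hi)
  have hb := key _ _ _ (vecLpNorm_nonneg 2 b) (sq_add_sq_le_vecLpNorm_two_sq b hj)
  have hc := abs_le_vecLpNorm_two c k
  have hna := vecLpNorm_nonneg 2 a
  have hnb := vecLpNorm_nonneg 2 b
  calc _ ≤ |(p * a i + q * a i') * (p * b j + q * b j') * c k| := le_abs_self _
    _ = |p * a i + q * a i'| * |p * b j + q * b j'| * |c k| := by rw [abs_mul, abs_mul]
    _ ≤ (√(p ^ 2 + q ^ 2) * vecLpNorm 2 a) * (√(p ^ 2 + q ^ 2) * vecLpNorm 2 b)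
        * vecLpNorm 2 c := by gcongr
    _ = √(p ^ 2 + q ^ 2) ^ 2 * (vecLpNorm 2 a * vecLpNorm 2 b * vecLpNorm 2 c) := by ring
    _ = _ := by rw [Real.sq_sqrt (by positivity)]

lemma planar_inner_le_mul_norms {N₁ N₂ N₃ : ℕ} (a : Fin N₁ → ℝ) (b : Fin N₂ → ℝ)
    (c : Fin N₃ → ℝ) {i i' : Fin N₁} (hi : i ≠ i') {j j' : Fin N₂} (hj : j ≠ j') (k : Fin N₃) :
    a i * b j * c k + a i' * b j' * c k ≤ vecLpNorm 2 a * vecLpNorm 2 b * vecLpNorm 2 c := by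
  have hna := vecLpNorm_nonneg 2 a
  have hnb := vecLpNorm_nonneg 2 b
  have h : |a i * b j + a i' * b j'| ≤ vecLpNorm 2 a * vecLpNorm 2 b := by
    refine abs_le_of_sq_le_sq ?_ (by positivity)
    rw [mul_pow]
    have := mul_le_mul (sq_add_sq_le_vecLpNorm_two_sq a hi) (sq_add_sq_le_vecLpNorm_two_sq b hj)
      (by positivity) (by positivity)
    nlinarith [sq_nonneg (a i * b j' - a i' * b j)]
  calc _ = (a i * b j + a i' * b j') * c k := by ring
    _ ≤ |a i * b j + a i' * b j'| * |c k| := by rw [← abs_mul]; exact le_abs_self _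
    _ ≤ _ := mul_le_mul h (abs_le_vecLpNorm_two c k) (abs_nonneg _) (by positivity)

/-- Lower bound for the value of any decomposition of a tensor having a `2 × 2` identity block. -/
lemma le_sum_rpow_of_identity_block {N₁ N₂ N₃ R : ℕ} {X : Fin N₁ × Fin N₂ × Fin N₃ → ℝ}
    {u1 : Fin R → Fin N₁ → ℝ} {u2 : Fin R → Fin N₂ → ℝ} {u3 : Fin R → Fin N₃ → ℝ}
    (h : IsCPDecomp X u1 u2 u3) {i i' : Fin N₁} (hi : i ≠ i') {j j' : Fin N₂} (hj : j ≠ j')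
    {k : Fin N₃} (h00 : X (i, j, k) = 1) (h01 : X (i, j', k) = 0) (h10 : X (i', j, k) = 0)
    (h11 : X (i', j', k) = 1) :
    23 / 10 ≤ (∑ r, (vecLpNorm 2 (u1 r) * vecLpNorm 2 (u2 r) * vecLpNorm 2 (u3 r))
      ^ ((2 : ℝ) / 3)) ^ ((3 : ℝ) / 2) := by
  set σ : Fin R → ℝ := fun r => vecLpNorm 2 (u1 r) * vecLpNorm 2 (u2 r) * vecLpNorm 2 (u3 r)
    with hσ
  have hσ0 : ∀ r, 0 ≤ σ r := fun r =>
    mul_nonneg (mul_nonneg (vecLpNorm_nonneg _ _) (vecLpNorm_nonneg _ _)) (vecLpNorm_nonneg _ _)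
  have htrace : 2 ≤ ∑ r, σ r := by
    calc (2 : ℝ) = X (i, j, k) + X (i', j', k) := by rw [h00, h11]; norm_num
      _ = ∑ r, (u1 r i * u2 r j * u3 r k + u1 r i' * u2 r j' * u3 r k) := by
        rw [h, h, Finset.sum_add_distrib]
      _ ≤ ∑ r, σ r := Finset.sum_le_sum fun r _ => planar_inner_le_mul_norms _ _ _ hi hj k
  have hcontr : ∀ p q : ℝ, p ^ 2 + q ^ 2 =
      ∑ r, (p * u1 r i + q * u1 r i') * (p * u2 r j + q * u2 r j') * u3 r k := by
    intro p q
    calc p ^ 2 + q ^ 2 = p ^ 2 * X (i, j, k) + p * q * X (i, j', k) + p * q * X (i', j, k)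
          + q ^ 2 * X (i', j', k) := by rw [h00, h01, h10, h11]; ring
      _ = _ := by
        rw [h, h, h, h]
        simp only [Finset.mul_sum, ← Finset.sum_add_distrib]
        exact Finset.sum_congr rfl fun r _ => by ring
  have hdrop : ∀ r₀, 1 ≤ ∑ r ∈ univ.erase r₀, σ r := by
    intro r₀
    obtain ⟨p, q, hpq, horth⟩ : ∃ p q : ℝ, 0 < p ^ 2 + q ^ 2 ∧
        p * u1 r₀ i + q * u1 r₀ i' = 0 := by
      by_cases h0 : u1 r₀ i = 0
      · exact ⟨1, 0, by norm_num, by simp [h0]⟩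
      · exact ⟨-u1 r₀ i', u1 r₀ i, by positivity, by ring⟩
    have hle : p ^ 2 + q ^ 2 ≤ (p ^ 2 + q ^ 2) * ∑ r ∈ univ.erase r₀, σ r := by
      calc p ^ 2 + q ^ 2 = ∑ r ∈ univ.erase r₀,
            (p * u1 r i + q * u1 r i') * (p * u2 r j + q * u2 r j') * u3 r k := by
            rw [hcontr p q, ← Finset.add_sum_erase _ _ (mem_univ r₀), horth]
            simp
        _ ≤ _ := by
          rw [Finset.mul_sum]
          exact Finset.sum_le_sum fun r _ => contraction_le_mul_norms _ _ _ hi hj k p q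
    exact le_of_mul_le_mul_left (by linarith) hpq
  have hcube : ∀ r, (σ r ^ ((1 : ℝ) / 3)) ^ 3 = σ r := fun r => by
    rw [← Real.rpow_natCast, ← Real.rpow_mul (hσ0 r)]; norm_num
  have hsq : ∀ r, (σ r ^ ((1 : ℝ) / 3)) ^ 2 = σ r ^ ((2 : ℝ) / 3) := fun r => by
    rw [← Real.rpow_natCast, ← Real.rpow_mul (hσ0 r)]; norm_num
  have hT := le_sum_sq_pow_three (fun r => σ r ^ ((1 : ℝ) / 3))
    (fun r => Real.rpow_nonneg (hσ0 r) _) (by simpa only [hcube] using htrace)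
    (by simpa only [hcube] using hdrop)
  simp only [hsq] at hT
  have hT0 : 0 ≤ ∑ r, σ r ^ ((2 : ℝ) / 3) :=
    Finset.sum_nonneg fun r _ => Real.rpow_nonneg (hσ0 r) _
  refine le_of_sq_le_sq ?_ (Real.rpow_nonneg hT0 _)
  rw [← Real.rpow_natCast (_ ^ ((3 : ℝ) / 2)), ← Real.rpow_mul hT0,
    show (3 : ℝ) / 2 * ((2 : ℕ) : ℝ) = ((3 : ℕ) : ℝ) by norm_num, Real.rpow_natCast]
  linarith

theorem stmt_5 {N₁ N₂ N₃ : ℕ} (hN₁ : 2 ≤ N₁) (hN₂ : 2 ≤ N₂) (hN₃ : 1 ≤ N₃) :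
    ∃ X Y : Fin N₁ × Fin N₂ × Fin N₃ → ℝ,
      (tensorNorm23 X + tensorNorm23 Y) / 2 <
        tensorNorm23 (fun t => (X t + Y t) / 2) := by
  obtain ⟨i, i', hi⟩ : ∃ i i' : Fin N₁, i ≠ i' :=
    ⟨⟨0, by omega⟩, ⟨1, by omega⟩, by simp⟩
  obtain ⟨j, j', hj⟩ : ∃ j j' : Fin N₂, j ≠ j' :=
    ⟨⟨0, by omega⟩, ⟨1, by omega⟩, by simp⟩
  let k : Fin N₃ := ⟨0, by omega⟩
  let E : Fin N₁ → Fin N₂ → Fin N₁ × Fin N₂ × Fin N₃ → ℝ := fun a b t =>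
    (Pi.single a 2 : Fin N₁ → ℝ) t.1 * (Pi.single b 1 : Fin N₂ → ℝ) t.2.1 *
      (Pi.single k 1 : Fin N₃ → ℝ) t.2.2
  have hE : ∀ a b, tensorNorm23 (E a b) ≤ 2 := fun a b =>
    (tensorNorm23_rankOne_le _ _ _).trans_eq (by simp [vecLpNorm_two_single])
  have hlower : 23 / 10 ≤ tensorNorm23 (fun t => (E i j t + E i' j' t) / 2) := by
    refine le_csInf ⟨_, 2, ![Pi.single i 1, Pi.single i' 1], ![Pi.single j 1, Pi.single j' 1],
      fun _ => Pi.single k 1, ?_, rfl⟩ ?_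
    · intro a b c
      simp only [E, Fin.sum_univ_two, Matrix.cons_val_zero, Matrix.cons_val_one, Pi.single_apply]
      split_ifs <;> norm_num
    · rintro y ⟨R, u1, u2, u3, h, rfl⟩
      exact le_sum_rpow_of_identity_block h hi hj (k := k) (by simp [E, hi, hj])
        (by simp [E, hi, hj.symm]) (by simp [E, hi.symm, hj]) (by simp [E, hi.symm, hj.symm])
  exact ⟨E i j, E i' j', by linarith [hE i j, hE i' j']⟩
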